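/- Let m,n ≥ 1 and let ℙ be a Borel regular probability measure on the space 𝒢_{m,n} of MILP instances of size (m,n) such that ℙ[SB(G) ∈ ℝ^n] = 1. Then for every ε > 0 and every δ > 0 there exists a 2-FGNN F of size (m,n) such that ℙ[‖F(G) − SB(G)‖ ≤ δ] ≥ 1 − ε, where ‖·‖ denotes the Euclidean norm on ℝ^n. -/

import Mathlib

open scoped BigOperators Classical
open MeasureTheory

noncomputable section

/-- Type of constraint senses: `0` is `≤`, `1` is `=`, `2` is `≥`. -/
abbrev Sense : Type := Fin 3

/-- Extended lower bounds: `Sum.inl a` is a real bound, `Sum.inr ()` is `-∞`. -/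
abbrev ExtLo : Type := ℝ ⊕ Unit

/-- Extended upper bounds: `Sum.inl a` is a real bound, `Sum.inr ()` is `+∞`. -/
abbrev ExtHi : Type := ℝ ⊕ Unit

def senseRel (s : Sense) (a b : ℝ) : Prop :=
  if s = 0 then a ≤ b else if s = 1 then a = b else b ≤ a

def loSat (lo : ExtLo) (x : ℝ) : Prop :=
  match lo with
  | Sum.inl a => a ≤ x
  | Sum.inr _ => True

def hiSat (hi : ExtHi) (x : ℝ) : Prop :=
  match hi with
  | Sum.inl a => x ≤ a
  | Sum.inr _ => True

/-- The space `𝒢_{m,n}` of MILP instances of size `(m,n)`: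
`(A, b, c, ∘, l, u, I)`, with `I` encoded as a Boolean indicator vector. -/
abbrev MILP (m n : ℕ) : Type :=
  (Fin m → Fin n → ℝ) × (Fin m → ℝ) × (Fin n → ℝ) × (Fin m → Sense) ×
  (Fin n → ExtLo) × (Fin n → ExtHi) × (Fin n → Bool)

namespace MILP

variable {m n : ℕ}

def A (G : MILP m n) : Fin m → Fin n → ℝ := G.1
def b (G : MILP m n) : Fin m → ℝ := G.2.1
def c (G : MILP m n) : Fin n → ℝ := G.2.2.1
def sense (G : MILP m n) : Fin m → Sense := G.2.2.2.1
def lo (G : MILP m n) : Fin n → ExtLo := G.2.2.2.2.1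
def hi (G : MILP m n) : Fin n → ExtHi := G.2.2.2.2.2.1
def isInt (G : MILP m n) : Fin n → Bool := G.2.2.2.2.2.2

end MILP

/-- Satisfaction of the linear constraints `(Ax) ∘ b`. -/
def consSat {m n : ℕ} (G : MILP m n) (x : Fin n → ℝ) : Prop :=
  ∀ i, senseRel (MILP.sense G i) (∑ j, MILP.A G i j * x j) (MILP.b G i)

/-- Feasible set of the LP relaxation of `G`. -/
def lpFeasSet {m n : ℕ} (G : MILP m n) : Set (Fin n → ℝ) :=
  {x | consSat G x ∧ ∀ j, loSat (MILP.lo G j) (x j) ∧ hiSat (MILP.hi G j) (x j)}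

/-- Feasible set of `LP(G, j, lo', hi')`: the LP relaxation of `G` with the bound
constraint on variable `j` replaced by `lo' ≤ x_j ≤ hi'`. -/
def feasSetMod {m n : ℕ} (G : MILP m n) (j : Fin n) (lo' : ExtLo) (hi' : ExtHi) :
    Set (Fin n → ℝ) :=
  {x | consSat G x ∧ (∀ j', j' ≠ j → loSat (MILP.lo G j') (x j') ∧ hiSat (MILP.hi G j') (x j'))
      ∧ loSat lo' (x j) ∧ hiSat hi' (x j)}

/-- Optimal value (in `ℝ ∪ {±∞}`) of the LP `min cᵀx` over `S`:
`+∞` if infeasible, `-∞` if unbounded below. -/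
def lpVal {n : ℕ} (c : Fin n → ℝ) (S : Set (Fin n → ℝ)) : EReal :=
  ⨅ x ∈ S, ((∑ j, c j * x j : ℝ) : EReal)

/-- `f*(G)`: optimal value of the LP relaxation of `G`. -/
def fstar {m n : ℕ} (G : MILP m n) : EReal := lpVal (MILP.c G) (lpFeasSet G)

/-- `f*(G, j, lo', hi')`: optimal value of `LP(G, j, lo', hi')`. -/
def lpValMod {m n : ℕ} (G : MILP m n) (j : Fin n) (lo' : ExtLo) (hi' : ExtHi) : EReal :=
  lpVal (MILP.c G) (feasSetMod G j lo' hi')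

/-- The Euclidean norm on `ℝⁿ` (as `Fin n → ℝ`). -/
def euclNorm {n : ℕ} (x : Fin n → ℝ) : ℝ := Real.sqrt (∑ j, x j ^ 2)

/-- The Euclidean distance on `ℝⁿ`. -/
def euclDist {n : ℕ} (x y : Fin n → ℝ) : ℝ := euclNorm (fun j => x j - y j)

/-- `x` is an optimal solution of the LP relaxation of `G`. -/
def IsOptSol {m n : ℕ} (G : MILP m n) (x : Fin n → ℝ) : Prop :=
  x ∈ lpFeasSet G ∧ ((∑ j, MILP.c G j * x j : ℝ) : EReal) = fstar G

/-- `x` is an optimal solution of smallest Euclidean norm of the LP relaxation of `G`. -/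
def IsMinNormOpt {m n : ℕ} (G : MILP m n) (x : Fin n → ℝ) : Prop :=
  IsOptSol G x ∧ ∀ y, IsOptSol G y → euclNorm x ≤ euclNorm y

/-- `x*(G)`: the optimal solution of smallest Euclidean norm of the LP relaxation
(defaults to `0` when it does not exist). -/
def xstar {m n : ℕ} (G : MILP m n) : Fin n → ℝ :=
  if h : ∃ x, IsMinNormOpt G x then h.choose else 0

/-- `f*(G, j, l_j, ⌊x*(G)_j⌋)`. -/
def branchDown {m n : ℕ} (G : MILP m n) (j : Fin n) : EReal :=
  lpValMod G j (MILP.lo G j) (Sum.inl ((⌊xstar G j⌋ : ℤ) : ℝ))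

/-- `f*(G, j, ⌈x*(G)_j⌉, u_j)`. -/
def branchUp {m n : ℕ} (G : MILP m n) (j : Fin n) : EReal :=
  lpValMod G j (Sum.inl ((⌈xstar G j⌉ : ℤ) : ℝ)) (MILP.hi G j)

/-- The strong branching score vector `SB(G) ∈ ℝⁿ`. -/
def SB {m n : ℕ} (G : MILP m n) : Fin n → ℝ := fun j =>
  if MILP.isInt G j then
    ((branchDown G j).toReal - (fstar G).toReal) * ((branchUp G j).toReal - (fstar G).toReal)
  else 0

/-- `SB(G) ∈ ℝⁿ`: the LP relaxation of `G` is feasible and bounded (so that the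
min-norm optimal solution `x*(G)` exists and `f*(G)` is finite), and all the
branch LP values entering the strong branching scores are finite. -/
def SBRealValued {m n : ℕ} (G : MILP m n) : Prop :=
  (∃ x, IsMinNormOpt G x) ∧ fstar G ≠ ⊤ ∧ fstar G ≠ ⊥ ∧
  ∀ j, MILP.isInt G j →
    branchDown G j ≠ ⊤ ∧ branchDown G j ≠ ⊥ ∧ branchUp G j ≠ ⊤ ∧ branchUp G j ≠ ⊥

/-! ### WL colors -/

abbrev VFeat : Type := ℝ × Sense
abbrev WFeat : Type := ℝ × ExtLo × ExtHi × Bool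

/-- The pair (type of constraint-node colors, type of variable-node colors) at
each round of the WL test. -/
def WLTypes : ℕ → Type × Type
  | 0 => (VFeat, WFeat)
  | l + 1 =>
      ((WLTypes l).1 × Multiset ((WLTypes l).2 × ℝ),
       (WLTypes l).2 × Multiset ((WLTypes l).1 × ℝ))

abbrev VColor (l : ℕ) : Type := (WLTypes l).1
abbrev WColor (l : ℕ) : Type := (WLTypes l).2

/-- The canonical WL colors of a MILP instance: `(wl G l).1 i = C_l^V(i)` and
`(wl G l).2 j = C_l^W(j)`. -/
def wl {m n : ℕ} (G : MILP m n) : (l : ℕ) → (Fin m → VColor l) × (Fin n → WColor l)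
  | 0 =>
      (fun i => (MILP.b G i, MILP.sense G i),
       fun j => (MILP.c G j, MILP.lo G j, MILP.hi G j, MILP.isInt G j))
  | l + 1 =>
      (fun i => ((wl G l).1 i,
        (Finset.univ.filter (fun j => MILP.A G i j ≠ 0)).val.map
          (fun j => ((wl G l).2 j, MILP.A G i j))),
       fun j => ((wl G l).2 j,
        (Finset.univ.filter (fun i => MILP.A G i j ≠ 0)).val.map
          (fun i => ((wl G l).1 i, MILP.A G i j))))

/-- `G` is message-passing-tractable: whenever two constraints and two variables are
respectively indistinguishable by all rounds of the WL test, the corresponding matrix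
entries agree (i.e. every submatrix of `A` over a pair of classes of the stable WL
partition is constant). -/
def MPTractable {m n : ℕ} (G : MILP m n) : Prop :=
  ∀ i i' j j', (∀ l, (wl G l).1 i = (wl G l).1 i') → (∀ l, (wl G l).2 j = (wl G l).2 j') →
    MILP.A G i j = MILP.A G i' j'

/-- `G ∼^W G2`. -/
def WLEquivW {m n : ℕ} (G G2 : MILP m n) : Prop :=
  ∀ l, Finset.univ.val.map ((wl G l).1) = Finset.univ.val.map ((wl G2 l).1)
    ∧ ∀ j, (wl G l).2 j = (wl G2 l).2 j

/-! ### MP-GNNs -/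

/-- A message-passing GNN of size `(m,n)`. -/
structure MPGNN (m n : ℕ) where
  L : ℕ
  d : ℕ → ℕ
  e : ℕ → ℕ
  p0 : ℝ × Sense → (Fin (d 0) → ℝ)
  q0 : ℝ × ExtLo × ExtHi × Bool → (Fin (d 0) → ℝ)
  f : (l : ℕ) → (Fin (d l) → ℝ) × ℝ → (Fin (e l) → ℝ)
  g : (l : ℕ) → (Fin (d l) → ℝ) × ℝ → (Fin (e l) → ℝ)
  p : (l : ℕ) → (Fin (d l) → ℝ) × (Fin (e l) → ℝ) → (Fin (d (l + 1)) → ℝ)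
  q : (l : ℕ) → (Fin (d l) → ℝ) × (Fin (e l) → ℝ) → (Fin (d (l + 1)) → ℝ)
  r : (Fin (d L) → ℝ) × (Fin (d L) → ℝ) × (Fin (d L) → ℝ) → ℝ
  p0_cont : Continuous p0
  q0_cont : Continuous q0
  f_cont : ∀ l, Continuous (f l)
  g_cont : ∀ l, Continuous (g l)
  p_cont : ∀ l, Continuous (p l)
  q_cont : ∀ l, Continuous (q l)
  r_cont : Continuous r
  f_zero : ∀ l t, f l (t, 0) = 0
  g_zero : ∀ l s, g l (s, 0) = 0

namespace MPGNN

variable {m n : ℕ}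

/-- The features of an MP-GNN on input `G` after `l` layers:
`(st N G l).1 i = s_i^l` and `(st N G l).2 j = t_j^l`. -/
def st (N : MPGNN m n) (G : MILP m n) :
    (l : ℕ) → (Fin m → (Fin (N.d l) → ℝ)) × (Fin n → (Fin (N.d l) → ℝ))
  | 0 =>
      (fun i => N.p0 (MILP.b G i, MILP.sense G i),
       fun j => N.q0 (MILP.c G j, MILP.lo G j, MILP.hi G j, MILP.isInt G j))
  | l + 1 =>
      (fun i => N.p l ((st N G l).1 i, ∑ j, N.f l ((st N G l).2 j, MILP.A G i j)),
       fun j => N.q l ((st N G l).2 j, ∑ i, N.g l ((st N G l).1 i, MILP.A G i j)))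

/-- The output `F(G) ∈ ℝⁿ` of an MP-GNN. -/
def eval (N : MPGNN m n) (G : MILP m n) : Fin n → ℝ := fun j =>
  N.r (∑ i, (st N G N.L).1 i, ∑ j', (st N G N.L).2 j', (st N G N.L).2 j)

end MPGNN

/-! ### 2-FWL colors -/

/-- The pair (type of `(V,W)`-pair colors, type of `(W,W)`-pair colors) at each
round of the 2-FWL test. -/
def FWLTypes : ℕ → Type × Type
  | 0 => (VFeat × WFeat × ℝ, WFeat × WFeat × Bool)
  | l + 1 =>
      ((FWLTypes l).1 × Multiset ((FWLTypes l).2 × (FWLTypes l).1),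
       (FWLTypes l).2 × Multiset ((FWLTypes l).1 × (FWLTypes l).1))

abbrev VWColor (l : ℕ) : Type := (FWLTypes l).1
abbrev WWColor (l : ℕ) : Type := (FWLTypes l).2

/-- The canonical 2-FWL colors of a MILP instance: `(fwl G l).1 i j = C_l^{VW}(i,j)` and
`(fwl G l).2 j₁ j₂ = C_l^{WW}(j₁,j₂)`. -/
def fwl {m n : ℕ} (G : MILP m n) :
    (l : ℕ) → (Fin m → Fin n → VWColor l) × (Fin n → Fin n → WWColor l)
  | 0 =>
      (fun i j => ((MILP.b G i, MILP.sense G i),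
        (MILP.c G j, MILP.lo G j, MILP.hi G j, MILP.isInt G j), MILP.A G i j),
       fun j1 j2 => ((MILP.c G j1, MILP.lo G j1, MILP.hi G j1, MILP.isInt G j1),
        (MILP.c G j2, MILP.lo G j2, MILP.hi G j2, MILP.isInt G j2), decide (j1 = j2)))
  | l + 1 =>
      (fun i j => ((fwl G l).1 i j,
        Finset.univ.val.map (fun j1 => ((fwl G l).2 j1 j, (fwl G l).1 i j1))),
       fun j1 j2 => ((fwl G l).2 j1 j2,
        Finset.univ.val.map (fun i => ((fwl G l).1 i j2, (fwl G l).1 i j1))))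

/-- `G ∼₂ G2`. -/
def FWLEquiv {m n : ℕ} (G G2 : MILP m n) : Prop :=
  ∀ l, (Finset.univ : Finset (Fin m × Fin n)).val.map (fun p => (fwl G l).1 p.1 p.2)
        = (Finset.univ : Finset (Fin m × Fin n)).val.map (fun p => (fwl G2 l).1 p.1 p.2)
    ∧ (Finset.univ : Finset (Fin n × Fin n)).val.map (fun p => (fwl G l).2 p.1 p.2)
        = (Finset.univ : Finset (Fin n × Fin n)).val.map (fun p => (fwl G2 l).2 p.1 p.2)

/-- `G ∼₂^W G2`. -/
def FWLEquivW {m n : ℕ} (G G2 : MILP m n) : Prop :=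
  ∀ l, ∀ j, Finset.univ.val.map (fun i => (fwl G l).1 i j)
        = Finset.univ.val.map (fun i => (fwl G2 l).1 i j)
    ∧ Finset.univ.val.map (fun j1 => (fwl G l).2 j1 j)
        = Finset.univ.val.map (fun j1 => (fwl G2 l).2 j1 j)

/-! ### 2-FGNNs -/

/-- A second-order folklore GNN of size `(m,n)`. -/
structure FGNN2 (m n : ℕ) where
  L : ℕ
  d : ℕ → ℕ
  e : ℕ → ℕ
  p0 : VFeat × WFeat × ℝ → (Fin (d 0) → ℝ)
  q0 : WFeat × WFeat × Bool → (Fin (d 0) → ℝ)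
  f : (l : ℕ) → (Fin (d l) → ℝ) × (Fin (d l) → ℝ) → (Fin (e l) → ℝ)
  g : (l : ℕ) → (Fin (d l) → ℝ) × (Fin (d l) → ℝ) → (Fin (e l) → ℝ)
  p : (l : ℕ) → (Fin (d l) → ℝ) × (Fin (e l) → ℝ) → (Fin (d (l + 1)) → ℝ)
  q : (l : ℕ) → (Fin (d l) → ℝ) × (Fin (e l) → ℝ) → (Fin (d (l + 1)) → ℝ)
  r : (Fin (d L) → ℝ) × (Fin (d L) → ℝ) → ℝ
  p0_cont : Continuous p0
  q0_cont : Continuous q0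
  f_cont : ∀ l, Continuous (f l)
  g_cont : ∀ l, Continuous (g l)
  p_cont : ∀ l, Continuous (p l)
  q_cont : ∀ l, Continuous (q l)
  r_cont : Continuous r

namespace FGNN2

variable {m n : ℕ}

/-- The features of a 2-FGNN on input `G` after `l` layers:
`(st N G l).1 i j = s_{ij}^l` and `(st N G l).2 j₁ j₂ = t_{j₁j₂}^l`. -/
def st (N : FGNN2 m n) (G : MILP m n) :
    (l : ℕ) → (Fin m → Fin n → (Fin (N.d l) → ℝ)) × (Fin n → Fin n → (Fin (N.d l) → ℝ))
  | 0 =>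
      (fun i j => N.p0 ((MILP.b G i, MILP.sense G i),
        (MILP.c G j, MILP.lo G j, MILP.hi G j, MILP.isInt G j), MILP.A G i j),
       fun j1 j2 => N.q0 ((MILP.c G j1, MILP.lo G j1, MILP.hi G j1, MILP.isInt G j1),
        (MILP.c G j2, MILP.lo G j2, MILP.hi G j2, MILP.isInt G j2), decide (j1 = j2)))
  | l + 1 =>
      (fun i j => N.p l ((st N G l).1 i j, ∑ j1, N.f l ((st N G l).2 j1 j, (st N G l).1 i j1)),
       fun j1 j2 => N.q l ((st N G l).2 j1 j2, ∑ i, N.g l ((st N G l).1 i j2, (st N G l).1 i j1)))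

/-- The output `F(G) ∈ ℝⁿ` of a 2-FGNN. -/
def eval (N : FGNN2 m n) (G : MILP m n) : Fin n → ℝ := fun j =>
  N.r (∑ i, (st N G N.L).1 i j, ∑ j1, (st N G N.L).2 j1 j)

end FGNN2

/-- A map `φ` is sum-separating on `ι`-indexed families if equality of the sums of `φ` along two
families forces the families to agree up to a permutation. -/
def SumSeparating {X E : Type*} [AddCommMonoid E] (ι : Type*) [Fintype ι] (φ : X → E) : Prop :=
  ∀ x y : ι → X, ∑ k, φ (x k) = ∑ k, φ (y k) → ∃ σ : Equiv.Perm ι, ∀ k, x k = y (σ k)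

theorem SumSeparating.injective {X E : Type*} [AddCommMonoid E] {ι : Type*} [Fintype ι]
    [Nonempty ι] {φ : X → E} (h : SumSeparating ι φ) : Function.Injective φ := by
  intro a b hab
  obtain ⟨σ, hσ⟩ := h (fun _ => a) (fun _ => b) (by simp [hab])
  exact hσ (Classical.arbitrary ι)

theorem SumSeparating.comp {X Y E : Type*} [AddCommMonoid E] {ι : Type*} [Fintype ι]
    {φ : Y → E} (h : SumSeparating ι φ) {e : X → Y} (he : Function.Injective e) :
    SumSeparating ι (φ ∘ e) := by
  intro x y hxy
  obtain ⟨σ, hσ⟩ := h (e ∘ x) (e ∘ y) hxy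
  exact ⟨σ, fun k => he (hσ k)⟩

/-- Two families whose fibers have equal cardinalities agree up to a permutation. -/
theorem exists_perm_of_card_fiber {ι X : Type*} [Fintype ι] (x y : ι → X)
    (h : ∀ p, (Finset.univ.filter fun k => x k = p).card
      = (Finset.univ.filter fun k => y k = p).card) :
    ∃ σ : Equiv.Perm ι, ∀ k, x k = y (σ k) := by
  have e : ∀ p, Nonempty ({k // x k = p} ≃ {k // y k = p}) := fun p =>
    ⟨Fintype.equivOfCardEq (by simpa [Fintype.card_subtype] using h p)⟩
  exact ⟨Equiv.ofFiberEquiv fun p => (e p).some,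
    fun k => (Equiv.ofFiberEquiv_map (fun p => (e p).some) k).symm⟩

/-- The vector of all products of `B`-many factors taken among `1` and the coordinates. -/
def monomialMap (B κ : Type*) [Fintype B] (v : κ → ℝ) : (B → Option κ) → ℝ :=
  fun s => ∏ b, (s b).elim 1 v

theorem continuous_monomialMap (B κ : Type*) [Fintype B] : Continuous (monomialMap B κ) := by
  refine continuous_pi fun s => continuous_finsetProd _ fun b _ => ?_
  cases s b with
  | none => exact continuous_const
  | some k => exact continuous_apply k

/-- A Lagrange polynomial for the point `p` among the points `z b` is linear in the monomials. -/
theorem exists_lagrange_monomialMap {B κ : Type*} [Fintype B] [Fintype κ] (z : B → κ → ℝ)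
    (p : κ → ℝ) :
    ∃ a : (B → Option κ) → ℝ, (∑ s, a s * monomialMap B κ p s ≠ 0) ∧
      ∀ b, z b ≠ p → ∑ s, a s * monomialMap B κ (z b) s = 0 := by
  have hlin : ∀ b, ∃ w : Option κ → ℝ, (∑ o, w o * o.elim 1 p = 1) ∧
      (z b ≠ p → ∑ o, w o * o.elim 1 (z b) = 0) := by
    intro b
    by_cases hb : z b = p
    · exact ⟨fun o => o.elim 1 fun _ => 0, by simp [Fintype.sum_option], fun h => absurd hb h⟩
    · obtain ⟨k, hk⟩ := Function.ne_iff.mp hb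
      have hk' : p k - z b k ≠ 0 := sub_ne_zero.mpr (Ne.symm hk)
      refine ⟨fun o => o.elim (-z b k / (p k - z b k))
        fun k' => if k' = k then 1 / (p k - z b k) else 0, ?_, fun _ => ?_⟩
      · simp [Fintype.sum_option]
        field_simp
        ring
      · simp [Fintype.sum_option]
        field_simp
        ring
  choose w hw1 hw0 using hlin
  have key : ∀ v : κ → ℝ, ∑ s : B → Option κ, (∏ b, w b (s b)) * monomialMap B κ v s
      = ∏ b, ∑ o, w b o * o.elim 1 v := by
    intro v
    rw [Finset.prod_univ_sum, Fintype.piFinset_univ]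
    exact Finset.sum_congr rfl fun s _ => by rw [monomialMap, Finset.prod_mul_distrib]
  refine ⟨fun s => ∏ b, w b (s b), ?_, fun b hb => ?_⟩
  · rw [key]
    simp [hw1]
  · rw [key]
    exact Finset.prod_eq_zero (Finset.mem_univ b) (hw0 b hb)

theorem sumSeparating_monomialMap {B κ ι : Type*} [Fintype B] [Fintype κ] [Fintype ι]
    (e : B → ι ⊕ ι) (he : Function.Surjective e) : SumSeparating ι (monomialMap B κ) := by
  intro x y hxy
  refine exists_perm_of_card_fiber x y fun p => ?_
  obtain ⟨a, hp, hz⟩ := exists_lagrange_monomialMap (fun b => Sum.elim x y (e b)) p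
  have hx : ∀ k, x k ≠ p → ∑ s, a s * monomialMap B κ (x k) s = 0 := by
    intro k hk
    obtain ⟨b, hb⟩ := he (Sum.inl k)
    simpa [hb, hk] using hz b
  have hy : ∀ k, y k ≠ p → ∑ s, a s * monomialMap B κ (y k) s = 0 := by
    intro k hk
    obtain ⟨b, hb⟩ := he (Sum.inr k)
    simpa [hb, hk] using hz b
  have count : ∀ u : ι → κ → ℝ, (∀ k, u k ≠ p → ∑ s, a s * monomialMap B κ (u k) s = 0) →
      ∑ s, a s * (∑ k, monomialMap B κ (u k)) s
        = (Finset.univ.filter fun k => u k = p).card * ∑ s, a s * monomialMap B κ p s := by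
    intro u hu
    simp only [Finset.sum_apply, Finset.mul_sum]
    rw [Finset.sum_comm, ← Finset.sum_filter_add_sum_filter_not _ (fun k => u k = p),
      Finset.sum_eq_zero (s := Finset.univ.filter fun k => ¬ u k = p)
        (fun k hk => hu k (Finset.mem_filter.mp hk).2), add_zero,
      Finset.sum_congr rfl (g := fun _ => ∑ s, a s * monomialMap B κ p s)
        (fun k hk => by rw [(Finset.mem_filter.mp hk).2])]
    simp [Finset.mul_sum]
  have h := (count x hx).symm.trans ((congrArg (fun t => ∑ s, a s * t s) hxy).trans (count y hy))
  have h' := Nat.cast_injective (mul_right_cancel₀ hp h)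
  convert h'

/-- Every space embedding in some `ℝᵈ` has continuous sum-separating features. -/
theorem exists_sumSeparating (m n : ℕ) (hm : 1 ≤ m) (hn : 1 ≤ n) {X : Type*} [TopologicalSpace X]
    {d : ℕ} (emb : X → Fin d → ℝ) (hc : Continuous emb) (hi : Function.Injective emb) :
    ∃ (e : ℕ) (φ : X → Fin e → ℝ), Continuous φ ∧ SumSeparating (Fin m) φ ∧
      SumSeparating (Fin n) φ := by
  have : Nonempty (Fin m) := ⟨⟨0, hm⟩⟩
  have : Nonempty (Fin n) := ⟨⟨0, hn⟩⟩
  let B := (Fin m ⊕ Fin m) × (Fin n ⊕ Fin n)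
  let eq := Fintype.equivFin (B → Option (Fin d))
  have key : ∀ (ι : Type) [Fintype ι] (e : B → ι ⊕ ι), Function.Surjective e →
      SumSeparating ι fun x => monomialMap B (Fin d) (emb x) ∘ eq.symm := by
    intro ι _ e he x y hxy
    refine (sumSeparating_monomialMap e he).comp hi x y ?_
    funext s
    simpa [Finset.sum_apply] using congrFun hxy (eq s)
  refine ⟨_, fun x => monomialMap B (Fin d) (emb x) ∘ eq.symm, ?_,
    key _ Prod.fst Prod.fst_surjective, key _ Prod.snd Prod.snd_surjective⟩
  exact continuous_pi fun s =>
    (continuous_apply (eq.symm s)).comp ((continuous_monomialMap B (Fin d)).comp hc)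

/-- `X` embeds continuously and injectively in some `ℝᵈ`. -/
def HasCoordinates (X : Type*) [TopologicalSpace X] : Prop :=
  ∃ (d : ℕ) (f : X → Fin d → ℝ), Continuous f ∧ Function.Injective f

theorem HasCoordinates.of_injective {X Y : Type*} [TopologicalSpace X] [TopologicalSpace Y]
    (hY : HasCoordinates Y) (g : X → Y) (hc : Continuous g) (hi : Function.Injective g) :
    HasCoordinates X := by
  obtain ⟨d, f, hf, hfi⟩ := hY
  exact ⟨d, f ∘ g, hf.comp hc, hfi.comp hi⟩

theorem hasCoordinates_pi (d : ℕ) : HasCoordinates (Fin d → ℝ) :=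
  ⟨d, id, continuous_id, Function.injective_id⟩

theorem hasCoordinates_real : HasCoordinates ℝ :=
  (hasCoordinates_pi 1).of_injective (fun x _ => x) (by fun_prop) fun _ _ h => congrFun h 0

theorem HasCoordinates.prod {X Y : Type*} [TopologicalSpace X] [TopologicalSpace Y]
    (hX : HasCoordinates X) (hY : HasCoordinates Y) : HasCoordinates (X × Y) := by
  obtain ⟨d, f, hf, hfi⟩ := hX
  obtain ⟨e, g, hg, hgi⟩ := hY
  refine ⟨d + e, fun p => Fin.append (f p.1) (g p.2), ?_, ?_⟩
  · refine continuous_pi fun k => ?_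
    refine Fin.addCases (fun i => ?_) (fun i => ?_) k
    · simp only [Fin.append_left]
      fun_prop
    · simp only [Fin.append_right]
      fun_prop
  · rintro ⟨a, b⟩ ⟨a', b'⟩ h
    refine Prod.ext (hfi (funext fun i => ?_)) (hgi (funext fun i => ?_))
    · simpa using congrFun h (Fin.castAdd e i)
    · simpa using congrFun h (Fin.natAdd d i)

theorem hasCoordinates_real_sum_unit : HasCoordinates (ℝ ⊕ Unit) := by
  refine (hasCoordinates_real.prod hasCoordinates_real).of_injective
    (Sum.elim (fun a => (a, 0)) fun _ => (0, 1)) ?_ ?_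
  · exact Continuous.sumElim (by fun_prop) (by fun_prop)
  · rintro (a | a) (b | b) h <;> simp_all

theorem hasCoordinates_fin (k : ℕ) : HasCoordinates (Fin k) :=
  hasCoordinates_real.of_injective (fun i => ((i : ℕ) : ℝ)) continuous_of_discreteTopology
    fun a b h => by simpa [Fin.ext_iff] using h

theorem hasCoordinates_bool : HasCoordinates Bool :=
  (hasCoordinates_fin 2).of_injective (fun b => if b then 1 else 0)
    continuous_of_discreteTopology (by decide)

theorem hasCoordinates_vFeat : HasCoordinates VFeat :=
  hasCoordinates_real.prod (hasCoordinates_fin 3)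

theorem hasCoordinates_wFeat : HasCoordinates WFeat :=
  hasCoordinates_real.prod (hasCoordinates_real_sum_unit.prod
    (hasCoordinates_real_sum_unit.prod hasCoordinates_bool))

/-- Every constituent map of the network is injective on multisets. -/
structure FGNN2.IsSeparating {m n : ℕ} (N : FGNN2 m n) : Prop where
  p0 : SumSeparating (Fin m) N.p0
  q0 : SumSeparating (Fin n) N.q0
  f : ∀ l, SumSeparating (Fin n) (N.f l)
  g : ∀ l, SumSeparating (Fin m) (N.g l)
  p : ∀ l, SumSeparating (Fin m) (N.p l)
  q : ∀ l, SumSeparating (Fin n) (N.q l)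

/-- There are separating networks of every depth. -/
theorem exists_isSeparating (m n : ℕ) (hm : 1 ≤ m) (hn : 1 ≤ n) (L : ℕ) :
    ∃ N : FGNN2 m n, N.L = L ∧ N.IsSeparating := by
  have ex : ∀ {X : Type} [TopologicalSpace X], HasCoordinates X →
      ∃ (e : ℕ) (φ : X → Fin e → ℝ), Continuous φ ∧ SumSeparating (Fin m) φ ∧
        SumSeparating (Fin n) φ := by
    rintro X _ ⟨d, f, hf, hfi⟩
    exact exists_sumSeparating m n hm hn f hf hfi
  obtain ⟨d0, φ0, hφ0, hφ0m, hφ0n⟩ :=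
    ex ((hasCoordinates_vFeat.prod (hasCoordinates_wFeat.prod hasCoordinates_real)).prod
      (hasCoordinates_wFeat.prod (hasCoordinates_wFeat.prod hasCoordinates_bool)))
  choose e φ hφ hφm hφn using fun d => ex ((hasCoordinates_pi d).prod (hasCoordinates_pi d))
  choose D χ hχ hχm hχn using fun d => ex ((hasCoordinates_pi d).prod (hasCoordinates_pi (e d)))
  let w : WFeat := (0, Sum.inl 0, Sum.inl 0, false)
  refine ⟨{
    L := L
    d := fun l => Nat.rec d0 (fun _ d => D d) l
    e := fun l => e (Nat.rec d0 (fun _ d => D d) l)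
    p0 := φ0 ∘ fun x => (x, (w, w, false))
    q0 := φ0 ∘ fun y => (((0, 0), w, 0), y)
    f := fun l => φ _
    g := fun l => φ _
    p := fun l => χ _
    q := fun l => χ _
    r := fun _ => 0
    p0_cont := hφ0.comp (by fun_prop)
    q0_cont := hφ0.comp (by fun_prop)
    f_cont := fun l => hφ _
    g_cont := fun l => hφ _
    p_cont := fun l => hχ _
    q_cont := fun l => hχ _
    r_cont := continuous_const }, rfl, ?_⟩
  exact {
    p0 := hφ0m.comp fun _ _ h => (Prod.ext_iff.mp h).1
    q0 := hφ0n.comp fun _ _ h => (Prod.ext_iff.mp h).2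
    f := fun l => hφn _
    g := fun l => hφm _
    p := fun l => hχm _
    q := fun l => hχn _ }

/-- Colorings `u, u'` of the variables and `w, w'` of the constraints of two instances which form
a common equitable partition, with the variables `j0` and `j0'` individualized. -/
structure Equitable {m n : ℕ} (G G' : MILP m n) (j0 j0' : Fin n) {C D : Type*}
    (u u' : Fin n → C) (w w' : Fin m → D) : Prop where
  perm_var : ∃ σ : Equiv.Perm (Fin n), ∀ j, u j = u' (σ j)
  perm_con : ∃ σ : Equiv.Perm (Fin m), ∀ i, w i = w' (σ i)
  c : ∀ j j', u j = u' j' → G.c j = G'.c j'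
  lo : ∀ j j', u j = u' j' → G.lo j = G'.lo j'
  hi : ∀ j j', u j = u' j' → G.hi j = G'.hi j'
  isInt : ∀ j j', u j = u' j' → G.isInt j = G'.isInt j'
  b : ∀ i i', w i = w' i' → G.b i = G'.b i'
  sense : ∀ i i', w i = w' i' → G.sense i = G'.sense i'
  pin : ∀ j j', u j = u' j' → (j = j0 ↔ j' = j0')
  base : u j0 = u' j0'
  row : ∀ i i', w i = w' i' → ∀ k,
    ∑ j, (if u j = k then G.A i j else 0) = ∑ j, if u' j = k then G'.A i' j else 0
  col : ∀ j j', u j = u' j' → ∀ k,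
    ∑ i, (if w i = k then G.A i j else 0) = ∑ i, if w' i = k then G'.A i j' else 0

theorem Equitable.symm {m n : ℕ} {G G' : MILP m n} {j0 j0' : Fin n} {C D : Type*}
    {u u' : Fin n → C} {w w' : Fin m → D} (h : Equitable G G' j0 j0' u u' w w') :
    Equitable G' G j0' j0 u' u w' w where
  perm_var := h.perm_var.elim fun σ hσ => ⟨σ.symm, fun j => by simp [hσ]⟩
  perm_con := h.perm_con.elim fun σ hσ => ⟨σ.symm, fun j => by simp [hσ]⟩
  c := fun j j' e => (h.c j' j e.symm).symm
  lo := fun j j' e => (h.lo j' j e.symm).symm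
  hi := fun j j' e => (h.hi j' j e.symm).symm
  isInt := fun j j' e => (h.isInt j' j e.symm).symm
  b := fun j j' e => (h.b j' j e.symm).symm
  sense := fun j j' e => (h.sense j' j e.symm).symm
  pin := fun j j' e => (h.pin j' j e.symm).symm
  base := h.base.symm
  row := fun i i' e k => (h.row i' i e.symm k).symm
  col := fun i i' e k => (h.col i' i e.symm k).symm

/-- A decreasing sequence of finite sets stalls early. -/
theorem exists_stable_of_antitone {α : Type*} [Fintype α] (E : ℕ → Finset α)
    (hE : ∀ l, E (l + 1) ⊆ E l) : ∃ l ≤ Fintype.card α, E (l + 1) = E l := by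
  by_contra! h
  have key : ∀ l ≤ Fintype.card α + 1, (E l).card + l ≤ Fintype.card α := by
    intro l
    induction l with
    | zero => exact fun _ => by simpa using Finset.card_le_univ (E 0)
    | succ l ih =>
      intro hl
      have := Finset.card_lt_card ((hE l).ssubset_of_ne (h l (by omega)))
      have := ih (by omega)
      omega
  have := key _ le_rfl
  omega

namespace FGNN2

variable {m n : ℕ} {N : FGNN2 m n}

theorem IsSeparating.vw_zero (hN : N.IsSeparating) [Nonempty (Fin m)] {G G' : MILP m n}
    {i i' : Fin m} {j j' : Fin n} (h : (st N G 0).1 i j = (st N G' 0).1 i' j') :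
    G.b i = G'.b i' ∧ G.sense i = G'.sense i' ∧ G.A i j = G'.A i' j' := by
  have := hN.p0.injective h
  simp only [Prod.mk.injEq] at this
  tauto

theorem IsSeparating.ww_zero (hN : N.IsSeparating) [Nonempty (Fin n)] {G G' : MILP m n}
    {j₁ j₁' j j' : Fin n} (h : (st N G 0).2 j₁ j = (st N G' 0).2 j₁' j') :
    G.c j₁ = G'.c j₁' ∧ G.lo j₁ = G'.lo j₁' ∧ G.hi j₁ = G'.hi j₁' ∧ G.isInt j₁ = G'.isInt j₁' ∧
      (j₁ = j ↔ j₁' = j') := by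
  have := hN.q0.injective h
  simp only [Prod.mk.injEq, decide_eq_decide] at this
  tauto

theorem IsSeparating.vw_succ (hN : N.IsSeparating) [Nonempty (Fin m)] {G G' : MILP m n} {l : ℕ}
    {i i' : Fin m} {j j' : Fin n} (h : (st N G (l + 1)).1 i j = (st N G' (l + 1)).1 i' j') :
    (st N G l).1 i j = (st N G' l).1 i' j' ∧ ∃ σ : Equiv.Perm (Fin n), ∀ k,
      (st N G l).2 k j = (st N G' l).2 (σ k) j' ∧ (st N G l).1 i k = (st N G' l).1 i' (σ k) := by
  have := (hN.p l).injective h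
  rw [Prod.mk.injEq] at this
  obtain ⟨σ, hσ⟩ := hN.f l _ _ this.2
  exact ⟨this.1, σ, fun k => Prod.mk.injEq _ _ _ _ ▸ hσ k⟩

theorem IsSeparating.ww_succ (hN : N.IsSeparating) [Nonempty (Fin n)] {G G' : MILP m n} {l : ℕ}
    {j₁ j₁' j j' : Fin n} (h : (st N G (l + 1)).2 j₁ j = (st N G' (l + 1)).2 j₁' j') :
    (st N G l).2 j₁ j = (st N G' l).2 j₁' j' ∧ ∃ σ : Equiv.Perm (Fin m), ∀ k,
      (st N G l).1 k j = (st N G' l).1 (σ k) j' ∧ (st N G l).1 k j₁ = (st N G' l).1 (σ k) j₁' := by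
  have := (hN.q l).injective h
  rw [Prod.mk.injEq] at this
  obtain ⟨σ, hσ⟩ := hN.g l _ _ this.2
  exact ⟨this.1, σ, fun k => Prod.mk.injEq _ _ _ _ ▸ hσ k⟩

theorem IsSeparating.vw_of_le (hN : N.IsSeparating) [Nonempty (Fin m)] {G G' : MILP m n}
    {l L : ℕ} (hl : l ≤ L) {i i' : Fin m} {j j' : Fin n}
    (h : (st N G L).1 i j = (st N G' L).1 i' j') : (st N G l).1 i j = (st N G' l).1 i' j' := by
  induction L, hl using Nat.le_induction with
  | base => exact h
  | succ L _ ih => exact ih (hN.vw_succ h).1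

theorem IsSeparating.ww_of_le (hN : N.IsSeparating) [Nonempty (Fin n)] {G G' : MILP m n}
    {l L : ℕ} (hl : l ≤ L) {i i' j j' : Fin n}
    (h : (st N G L).2 i j = (st N G' L).2 i' j') : (st N G l).2 i j = (st N G' l).2 i' j' := by
  induction L, hl using Nat.le_induction with
  | base => exact h
  | succ L _ ih => exact ih (hN.ww_succ h).1

theorem IsSeparating.vw_sum (hN : N.IsSeparating) {G G' : MILP m n} {l : ℕ} {j j' : Fin n}
    (h : ∑ i, (st N G l).1 i j = ∑ i, (st N G' l).1 i j') :
    ∃ σ : Equiv.Perm (Fin m), ∀ i, (st N G l).1 i j = (st N G' l).1 (σ i) j' := by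
  cases l with
  | zero =>
    obtain ⟨σ, hσ⟩ := hN.p0 _ _ h
    exact ⟨σ, fun i => congrArg N.p0 (hσ i)⟩
  | succ l =>
    obtain ⟨σ, hσ⟩ := hN.p l _ _ h
    exact ⟨σ, fun i => congrArg (N.p l) (hσ i)⟩

theorem IsSeparating.ww_sum (hN : N.IsSeparating) {G G' : MILP m n} {l : ℕ} {j j' : Fin n}
    (h : ∑ i, (st N G l).2 i j = ∑ i, (st N G' l).2 i j') :
    ∃ σ : Equiv.Perm (Fin n), ∀ i, (st N G l).2 i j = (st N G' l).2 (σ i) j' := by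
  cases l with
  | zero =>
    obtain ⟨σ, hσ⟩ := hN.q0 _ _ h
    exact ⟨σ, fun i => congrArg N.q0 (hσ i)⟩
  | succ l =>
    obtain ⟨σ, hσ⟩ := hN.q l _ _ h
    exact ⟨σ, fun i => congrArg (N.q l) (hσ i)⟩

/-- Pairs of node pairs, of two instances tagged by `Bool`, whose colors are compared. -/
abbrev ColorPairs (m n : ℕ) : Type :=
  (Bool × Fin m × Fin n) × (Bool × Fin m × Fin n) ⊕
    (Bool × Fin n × Fin n) × (Bool × Fin n × Fin n)

/-- The colors of two instances stabilize jointly, after a number of rounds bounded in terms of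
the size only. -/
theorem IsSeparating.exists_stable (hN : N.IsSeparating) [Nonempty (Fin m)] [Nonempty (Fin n)]
    (G G' : MILP m n) : ∃ l ≤ Fintype.card (ColorPairs m n),
      (∀ i i' j j', (st N G l).1 i j = (st N G' l).1 i' j' →
        (st N G (l + 1)).1 i j = (st N G' (l + 1)).1 i' j') ∧
      (∀ i i' j j', (st N G l).2 i j = (st N G' l).2 i' j' →
        (st N G (l + 1)).2 i j = (st N G' (l + 1)).2 i' j') := by
  let H : Bool → MILP m n := fun t => if t then G else G'
  let P : ℕ → ColorPairs m n → Prop := fun l => Sum.elim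
    (fun p => (st N (H p.1.1) l).1 p.1.2.1 p.1.2.2 = (st N (H p.2.1) l).1 p.2.2.1 p.2.2.2)
    (fun p => (st N (H p.1.1) l).2 p.1.2.1 p.1.2.2 = (st N (H p.2.1) l).2 p.2.2.1 p.2.2.2)
  obtain ⟨l, hl, hE⟩ := exists_stable_of_antitone (fun l => Finset.univ.filter (P l)) (by
    intro l
    refine Finset.monotone_filter_right _ ?_
    rintro (p | p) - hp
    · exact (hN.vw_succ hp).1
    · exact (hN.ww_succ hp).1)
  have hP : ∀ x, P l x → P (l + 1) x := fun x hx => by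
    have : x ∈ Finset.univ.filter (P (l + 1)) := hE ▸ Finset.mem_filter.mpr ⟨Finset.mem_univ x, hx⟩
    exact (Finset.mem_filter.mp this).2
  exact ⟨l, hl, fun i i' j j' h => hP (Sum.inl ((true, i, j), (false, i', j'))) h,
    fun i i' j j' h => hP (Sum.inr ((true, i, j), (false, i', j'))) h⟩

/-- Nodes with equal aggregated features of a deep separating network are matched by an equitable
pair of colorings. -/
theorem IsSeparating.exists_equitable (hN : N.IsSeparating) [Nonempty (Fin m)]
    [Nonempty (Fin n)] {G G' : MILP m n} {j0 j0' : Fin n} {L : ℕ}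
    (hL : Fintype.card (ColorPairs m n) ≤ L)
    (h1 : ∑ i, (st N G L).1 i j0 = ∑ i, (st N G' L).1 i j0')
    (h2 : ∑ j, (st N G L).2 j j0 = ∑ j, (st N G' L).2 j j0') :
    ∃ l, Equitable G G' j0 j0' (fun j => (st N G l).2 j j0) (fun j => (st N G' l).2 j j0')
      (fun i => (st N G l).1 i j0) (fun i => (st N G' l).1 i j0') := by
  obtain ⟨l, hl, hS, hT⟩ := hN.exists_stable G G'
  obtain ⟨σ, hσ⟩ := hN.vw_sum h1
  obtain ⟨τ, hτ⟩ := hN.ww_sum h2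
  have pin : ∀ j j', (st N G l).2 j j0 = (st N G' l).2 j' j0' → (j = j0 ↔ j' = j0') :=
    fun j j' h => (hN.ww_zero (hN.ww_of_le (Nat.zero_le l) h)).2.2.2.2
  have hτl : ∀ j, (st N G l).2 j j0 = (st N G' l).2 (τ j) j0' :=
    fun j => hN.ww_of_le (hl.trans hL) (hτ j)
  have var := fun j j' (h : (st N G l).2 j j0 = (st N G' l).2 j' j0') =>
    hN.ww_zero (hN.ww_of_le (Nat.zero_le l) h)
  have con := fun j j' (h : (st N G l).1 j j0 = (st N G' l).1 j' j0') =>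
    hN.vw_zero (hN.vw_of_le (Nat.zero_le l) h)
  refine ⟨l, ⟨⟨τ, hτl⟩, ⟨σ, fun i => hN.vw_of_le (hl.trans hL) (hσ i)⟩,
    fun j j' h => (var j j' h).1, fun j j' h => (var j j' h).2.1,
    fun j j' h => (var j j' h).2.2.1, fun j j' h => (var j j' h).2.2.2.1,
    fun j j' h => (con j j' h).1, fun j j' h => (con j j' h).2.1, pin, ?_, ?_, ?_⟩⟩
  · have := (pin j0 (τ j0) (hτl j0)).mp rfl
    exact (hτl j0).trans (by rw [this])
  · intro i i' h k
    obtain ⟨ρ, hρ⟩ := (hN.vw_succ (hS _ _ _ _ h)).2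
    refine Fintype.sum_equiv ρ _ _ fun j => ?_
    rw [(hρ j).1, (hN.vw_zero (hN.vw_of_le (Nat.zero_le l) (hρ j).2)).2.2]
  · intro j j' h k
    obtain ⟨ρ, hρ⟩ := (hN.ww_succ (hT _ _ _ _ h)).2
    refine Fintype.sum_equiv ρ _ _ fun i => ?_
    rw [(hρ i).1, (hN.vw_zero (hN.vw_of_le (Nat.zero_le l) (hρ i).2)).2.2]

end FGNN2

/-- Number of elements of color `k`. -/
def classSize {ι C : Type*} [Fintype ι] (u : ι → C) (k : C) : ℝ :=
  ∑ j, if u j = k then 1 else 0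

theorem classSize_pos {ι C : Type*} [Fintype ι] (u : ι → C) (j : ι) : 0 < classSize u (u j) := by
  refine Finset.sum_pos' (fun i _ => ?_) ⟨j, Finset.mem_univ j, by simp⟩
  split_ifs <;> norm_num

theorem classSize_congr {ι C : Type*} [Fintype ι] {u u' : ι → C}
    (h : ∃ σ : Equiv.Perm ι, ∀ j, u j = u' (σ j)) (k : C) : classSize u k = classSize u' k := by
  obtain ⟨σ, hσ⟩ := h
  exact Fintype.sum_equiv σ _ _ fun j => by rw [hσ]

/-- The matrix averaging over color classes. -/
def avgWeight {ι C : Type*} [Fintype ι] (u u' : ι → C) (j' j : ι) : ℝ :=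
  if u j = u' j' then (classSize u (u j))⁻¹ else 0

theorem avgWeight_nonneg {ι C : Type*} [Fintype ι] (u u' : ι → C) (j' j : ι) :
    0 ≤ avgWeight u u' j' j := by
  rw [avgWeight]
  split_ifs
  · exact inv_nonneg.mpr (classSize_pos u j).le
  · exact le_rfl

theorem avgWeight_ne_zero {ι C : Type*} [Fintype ι] {u u' : ι → C} {j' j : ι}
    (h : avgWeight u u' j' j ≠ 0) : u j = u' j' := by
  by_contra hne
  exact h (if_neg hne)

theorem sum_avgWeight_right {ι C : Type*} [Fintype ι] {u u' : ι → C}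
    (h : ∃ σ : Equiv.Perm ι, ∀ j, u j = u' (σ j)) (j' : ι) : ∑ j, avgWeight u u' j' j = 1 := by
  have hpos : 0 < classSize u (u' j') := by
    rw [classSize_congr h]
    exact classSize_pos u' j'
  have : ∀ j, avgWeight u u' j' j
      = (if u j = u' j' then 1 else 0) * (classSize u (u' j'))⁻¹ := by
    intro j
    rw [avgWeight]
    split_ifs with hj
    · rw [hj, one_mul]
    · rw [zero_mul]
  rw [Finset.sum_congr rfl fun j _ => this j, ← Finset.sum_mul]
  exact mul_inv_cancel₀ hpos.ne'

theorem sum_avgWeight_left {ι C : Type*} [Fintype ι] {u u' : ι → C}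
    (h : ∃ σ : Equiv.Perm ι, ∀ j, u j = u' (σ j)) (j : ι) : ∑ j', avgWeight u u' j' j = 1 := by
  have : ∀ j', avgWeight u u' j' j
      = (if u' j' = u j then 1 else 0) * (classSize u (u j))⁻¹ := by
    intro j'
    rw [avgWeight]
    simp only [eq_comm (a := u j)]
    split_ifs <;> simp
  rw [Finset.sum_congr rfl fun j _ => this j, ← Finset.sum_mul, classSize_congr h (u j)]
  exact mul_inv_cancel₀ (classSize_pos u j |>.trans_eq (classSize_congr h _)).ne'

/-- A convex combination stays in a convex set containing the points of nonzero weight. -/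
theorem Convex.sum_mem_of_ne_zero {ι : Type*} [Fintype ι] {s : Set ℝ} (hs : Convex ℝ s)
    {w z : ι → ℝ} (h0 : ∀ i, 0 ≤ w i) (h1 : ∑ i, w i = 1) (hz : ∀ i, w i ≠ 0 → z i ∈ s) :
    ∑ i, w i * z i ∈ s := by
  have key : ∀ v : ι → ℝ, ∑ i ∈ Finset.univ.filter (fun i => w i ≠ 0), w i * v i
      = ∑ i, w i * v i := by
    intro v
    refine Finset.sum_filter_of_ne fun i _ h => ?_
    exact left_ne_zero_of_mul h
  rw [← key]
  refine hs.sum_mem (fun i _ => h0 i) ?_ fun i hi => hz i (Finset.mem_filter.mp hi).2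
  simpa [h1] using key 1

theorem convex_senseRel (s : Sense) (b : ℝ) : Convex ℝ {a | senseRel s a b} := by
  unfold senseRel
  split_ifs
  · exact convex_Iic b
  · exact convex_singleton b
  · exact convex_Ici b

theorem convex_loSat (lo : ExtLo) : Convex ℝ {x | loSat lo x} := by
  rcases lo with a | a
  · exact convex_Ici a
  · exact convex_univ

theorem convex_hiSat (hi : ExtHi) : Convex ℝ {x | hiSat hi x} := by
  rcases hi with a | a
  · exact convex_Iic a
  · exact convex_univ

theorem lpFeasSet_eq_feasSetMod {m n : ℕ} (G : MILP m n) (j : Fin n) :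
    lpFeasSet G = feasSetMod G j (G.lo j) (G.hi j) := by
  ext x
  refine and_congr_right fun _ => ⟨fun h => ⟨fun j' _ => h j', h j⟩, fun h j' => ?_⟩
  by_cases hj : j' = j
  · exact hj ▸ h.2
  · exact h.1 j' hj

namespace Equitable

variable {m n : ℕ} {G G' : MILP m n} {j0 j0' : Fin n} {C D : Type*}
  {u u' : Fin n → C} {w w' : Fin m → D}

theorem intertwine (h : Equitable G G' j0 j0' u u' w w') (i' : Fin m) (j : Fin n) :
    ∑ j', G'.A i' j' * avgWeight u u' j' j = ∑ i, avgWeight w w' i' i * G.A i j := by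
  have hw : 0 < classSize w (w' i') := by
    rw [classSize_congr h.perm_con]
    exact classSize_pos w' i'
  have hu := classSize_pos u j
  have lhs : ∑ j', G'.A i' j' * avgWeight u u' j' j
      = (∑ j', if u' j' = u j then G'.A i' j' else 0) * (classSize u (u j))⁻¹ := by
    rw [Finset.sum_mul]
    refine Finset.sum_congr rfl fun j' _ => ?_
    rw [avgWeight]
    simp only [eq_comm (a := u j)]
    split_ifs <;> simp
  have rhs : ∑ i, avgWeight w w' i' i * G.A i j
      = (∑ i, if w i = w' i' then G.A i j else 0) * (classSize w (w' i'))⁻¹ := by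
    rw [Finset.sum_mul]
    refine Finset.sum_congr rfl fun i _ => ?_
    rw [avgWeight]
    split_ifs with hi
    · rw [hi, mul_comm]
    · simp
  have colG : ∀ j₁, u j₁ = u j → ∑ i, (if w i = w' i' then G.A i j₁ else 0)
      = ∑ i, if w i = w' i' then G.A i j else 0 := by
    intro j₁ h₁
    obtain ⟨σ, hσ⟩ := h.perm_var
    rw [h.col j₁ (σ j) (h₁.trans (hσ j)), h.col j (σ j) (hσ j)]
  have count : classSize u (u j) * (∑ i, if w i = w' i' then G.A i j else 0)
      = classSize w (w' i') * ∑ j', if u' j' = u j then G'.A i' j' else 0 := by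
    rw [classSize, Finset.sum_mul, classSize, Finset.sum_mul]
    calc ∑ j₁, (if u j₁ = u j then (1 : ℝ) else 0) * (∑ i, if w i = w' i' then G.A i j else 0)
        = ∑ j₁, ∑ i, if u j₁ = u j then (if w i = w' i' then G.A i j₁ else 0) else 0 := by
          refine Finset.sum_congr rfl fun j₁ _ => ?_
          split_ifs with h₁
          · rw [one_mul, colG j₁ h₁]
          · simp
      _ = ∑ i, ∑ j₁, if u j₁ = u j then (if w i = w' i' then G.A i j₁ else 0) else 0 :=
          Finset.sum_comm
      _ = _ := by
          refine Finset.sum_congr rfl fun i _ => ?_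
          split_ifs with hi
          · rw [one_mul, h.row i i' hi]
          · simp
  rw [lhs, rhs, ← div_eq_mul_inv, ← div_eq_mul_inv, div_eq_div_iff hu.ne' hw.ne']
  linarith

/-- Transport of a vector by averaging over the color classes. -/
theorem exists_transport (h : Equitable G G' j0 j0' u u' w w') (x : Fin n → ℝ) :
    ∃ y : Fin n → ℝ, y j0' = x j0 ∧ ∑ j, G'.c j * y j = ∑ j, G.c j * x j ∧
      ∑ j, y j ^ 2 ≤ ∑ j, x j ^ 2 ∧
      ∀ lo hi, x ∈ feasSetMod G j0 lo hi → y ∈ feasSetMod G' j0' lo hi := by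
  have hsum : ∀ a : Fin n → ℝ, ∀ j' (s : Set ℝ), Convex ℝ s → (∀ j, u j = u' j' → a j ∈ s) →
      ∑ j, avgWeight u u' j' j * a j ∈ s := fun a j' s hs ha =>
    hs.sum_mem_of_ne_zero (avgWeight_nonneg u u' j') (sum_avgWeight_right h.perm_var j')
      fun j hj => ha j (avgWeight_ne_zero hj)
  have hpin : ∑ j, avgWeight u u' j0' j * x j = x j0 :=
    hsum x j0' {x j0} (convex_singleton _) fun j hj => by rw [(h.pin j j0' hj).mpr rfl]; rfl
  refine ⟨fun j' => ∑ j, avgWeight u u' j' j * x j, hpin, ?_, ?_, ?_⟩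
  · simp only [Finset.mul_sum]
    rw [Finset.sum_comm]
    refine Finset.sum_congr rfl fun j _ => ?_
    rw [← one_mul (G.c j * x j), ← sum_avgWeight_left h.perm_var j, Finset.sum_mul]
    refine Finset.sum_congr rfl fun j' _ => ?_
    by_cases hj : u j = u' j'
    · rw [h.c j j' hj]
      ring
    · simp [avgWeight, hj]
  · calc ∑ j', (∑ j, avgWeight u u' j' j * x j) ^ 2
        ≤ ∑ j', ∑ j, avgWeight u u' j' j * x j ^ 2 := by
          refine Finset.sum_le_sum fun j' _ => ?_
          exact Real.pow_arith_mean_le_arith_mean_pow_of_even _ _ _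
            (fun j _ => avgWeight_nonneg u u' j' j) (sum_avgWeight_right h.perm_var j') even_two
      _ = ∑ j, x j ^ 2 := by
          rw [Finset.sum_comm]
          refine Finset.sum_congr rfl fun j _ => ?_
          rw [← Finset.sum_mul, sum_avgWeight_left h.perm_var, one_mul]
  · rintro lo hi ⟨hcons, hbd, hlo, hhi⟩
    refine ⟨fun i' => ?_, fun j' hj' => ⟨?_, ?_⟩, ?_, ?_⟩
    · have : ∑ j', G'.A i' j' * ∑ j, avgWeight u u' j' j * x j
          = ∑ i, avgWeight w w' i' i * ∑ j, G.A i j * x j := by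
        calc ∑ j', G'.A i' j' * ∑ j, avgWeight u u' j' j * x j
            = ∑ j, (∑ j', G'.A i' j' * avgWeight u u' j' j) * x j := by
              simp only [Finset.mul_sum, Finset.sum_mul]
              rw [Finset.sum_comm]
              simp only [mul_assoc]
          _ = _ := by
              simp only [h.intertwine, Finset.mul_sum, Finset.sum_mul]
              rw [Finset.sum_comm]
              simp only [mul_assoc]
      rw [this]
      refine (convex_senseRel (G'.sense i') (G'.b i')).sum_mem_of_ne_zero
        (avgWeight_nonneg w w' i') (sum_avgWeight_right h.perm_con i') fun i hi => ?_
      rw [← h.b i i' (avgWeight_ne_zero hi), ← h.sense i i' (avgWeight_ne_zero hi)]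
      exact hcons i
    · refine hsum x j' _ (convex_loSat _) fun j hj => ?_
      rw [← h.lo j j' hj]
      exact (hbd j fun e => hj' ((h.pin j j' hj).mp e)).1
    · refine hsum x j' _ (convex_hiSat _) fun j hj => ?_
      rw [← h.hi j j' hj]
      exact (hbd j fun e => hj' ((h.pin j j' hj).mp e)).2
    · exact (congrArg (loSat lo) hpin).mpr hlo
    · exact (congrArg (hiSat hi) hpin).mpr hhi

theorem lpValMod_le (h : Equitable G G' j0 j0' u u' w w') (lo : ExtLo) (hi : ExtHi) :
    lpValMod G' j0' lo hi ≤ lpValMod G j0 lo hi := by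
  refine le_iInf₂ fun x hx => ?_
  obtain ⟨y, -, hc, -, hy⟩ := h.exists_transport x
  rw [← hc]
  exact iInf₂_le y (hy lo hi hx)

theorem lpValMod_eq (h : Equitable G G' j0 j0' u u' w w') (lo : ExtLo) (hi : ExtHi) :
    lpValMod G j0 lo hi = lpValMod G' j0' lo hi :=
  le_antisymm (h.symm.lpValMod_le lo hi) (h.lpValMod_le lo hi)

theorem lo_eq (h : Equitable G G' j0 j0' u u' w w') : G.lo j0 = G'.lo j0' := h.lo _ _ h.base

theorem hi_eq (h : Equitable G G' j0 j0' u u' w w') : G.hi j0 = G'.hi j0' := h.hi _ _ h.base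

theorem fstar_eq (h : Equitable G G' j0 j0' u u' w w') : fstar G = fstar G' := by
  rw [fstar, fstar, lpFeasSet_eq_feasSetMod G j0, lpFeasSet_eq_feasSetMod G' j0', ← h.lo_eq,
    ← h.hi_eq]
  exact h.lpValMod_eq _ _

theorem exists_isOptSol (h : Equitable G G' j0 j0' u u' w w') {x : Fin n → ℝ}
    (hx : IsOptSol G x) : ∃ y, IsOptSol G' y ∧ y j0' = x j0 ∧ euclNorm y ≤ euclNorm x := by
  obtain ⟨y, hp, hc, hn, hy⟩ := h.exists_transport x
  refine ⟨y, ⟨?_, ?_⟩, hp, Real.sqrt_le_sqrt hn⟩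
  · rw [lpFeasSet_eq_feasSetMod G' j0', ← h.lo_eq, ← h.hi_eq]
    exact hy _ _ (lpFeasSet_eq_feasSetMod G j0 ▸ hx.1)
  · rw [hc, hx.2, h.fstar_eq]

end Equitable

theorem convex_lpFeasSet {m n : ℕ} (G : MILP m n) : Convex ℝ (lpFeasSet G) := by
  rintro x ⟨hx, hxb⟩ y ⟨hy, hyb⟩ a b ha hb hab
  refine ⟨fun i => ?_, fun j => ⟨?_, ?_⟩⟩
  · have : ∑ j, G.A i j * (a • x + b • y) j
        = a • (∑ j, G.A i j * x j) + b • ∑ j, G.A i j * y j := by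
      simp only [Pi.add_apply, Pi.smul_apply, smul_eq_mul, mul_add, Finset.sum_add_distrib,
        Finset.mul_sum]
      congr 1 <;> exact Finset.sum_congr rfl fun j _ => by ring
    rw [this]
    exact convex_senseRel _ _ (hx i) (hy i) ha hb hab
  · exact convex_loSat _ (hxb j).1 (hyb j).1 ha hb hab
  · exact convex_hiSat _ (hxb j).2 (hyb j).2 ha hb hab

theorem IsMinNormOpt.eq {m n : ℕ} {G : MILP m n} {x y : Fin n → ℝ} (hx : IsMinNormOpt G x)
    (hy : IsMinNormOpt G y) : x = y := by
  have hn : ∑ j, x j ^ 2 = ∑ j, y j ^ 2 := by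
    have := le_antisymm (hx.2 y hy.1) (hy.2 x hx.1)
    rwa [euclNorm, euclNorm, Real.sqrt_inj (by positivity) (by positivity)] at this
  have hc : ∑ j, G.c j * x j = ∑ j, G.c j * y j :=
    EReal.coe_injective (hx.1.2.trans hy.1.2.symm)
  let z : Fin n → ℝ := (1 / 2 : ℝ) • x + (1 / 2 : ℝ) • y
  have hz : IsOptSol G z := by
    refine ⟨convex_lpFeasSet G hx.1.1 hy.1.1 (by norm_num) (by norm_num) (by norm_num), ?_⟩
    rw [← hx.1.2]
    congr 1
    have : ∑ j, G.c j * z j = (∑ j, G.c j * x j) / 2 + (∑ j, G.c j * y j) / 2 := by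
      rw [Finset.sum_div, Finset.sum_div, ← Finset.sum_add_distrib]
      refine Finset.sum_congr rfl fun j _ => ?_
      simp only [z, Pi.add_apply, Pi.smul_apply, smul_eq_mul]
      ring
    rw [this, ← hc]
    ring
  have hle : ∑ j, x j ^ 2 ≤ ∑ j, z j ^ 2 :=
    (Real.sqrt_le_sqrt_iff (by positivity)).mp (hx.2 z hz)
  have hpar : ∑ j, z j ^ 2
      = (∑ j, x j ^ 2) / 2 + (∑ j, y j ^ 2) / 2 - (∑ j, (x j - y j) ^ 2) / 4 := by
    rw [Finset.sum_div, Finset.sum_div, Finset.sum_div, ← Finset.sum_add_distrib,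
      ← Finset.sum_sub_distrib]
    refine Finset.sum_congr rfl fun j _ => ?_
    simp only [z, Pi.add_apply, Pi.smul_apply, smul_eq_mul]
    ring
  have hzero : ∑ j, (x j - y j) ^ 2 = 0 :=
    le_antisymm (by linarith) (by positivity)
  funext j
  have := (Finset.sum_eq_zero_iff_of_nonneg fun j _ => sq_nonneg (x j - y j)).mp hzero j
    (Finset.mem_univ j)
  exact sub_eq_zero.mp (pow_eq_zero_iff two_ne_zero |>.mp this)

theorem isMinNormOpt_xstar {m n : ℕ} {G : MILP m n} (h : ∃ x, IsMinNormOpt G x) :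
    IsMinNormOpt G (xstar G) := by
  rw [xstar, dif_pos h]
  exact h.choose_spec

theorem Equitable.SB_eq {m n : ℕ} {G G' : MILP m n} {j0 j0' : Fin n} {C D : Type*}
    {u u' : Fin n → C} {w w' : Fin m → D} (h : Equitable G G' j0 j0' u u' w w')
    (hG : ∃ x, IsMinNormOpt G x) (hG' : ∃ x, IsMinNormOpt G' x) : SB G j0 = SB G' j0' := by
  have hx := isMinNormOpt_xstar hG
  have hx' := isMinNormOpt_xstar hG'
  obtain ⟨y, hy, hyj, hyn⟩ := h.exists_isOptSol hx.1
  obtain ⟨z, hz, -, hzn⟩ := h.symm.exists_isOptSol hx'.1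
  have hmin : IsMinNormOpt G' y :=
    ⟨hy, fun v hv => hyn.trans ((hx.2 z hz).trans (hzn.trans (hx'.2 v hv)))⟩
  have hstar : xstar G j0 = xstar G' j0' := by rw [← hyj, hmin.eq hx']
  rw [SB, SB, branchDown, branchDown, branchUp, branchUp, h.isInt _ _ h.base, h.fstar_eq, hstar,
    h.lo_eq, h.hi_eq, h.lpValMod_eq, h.lpValMod_eq]

theorem IsSigmaCompact.measurableSet {X : Type*} [TopologicalSpace X] [T2Space X]
    [MeasurableSpace X] [OpensMeasurableSpace X] {s : Set X} (hs : IsSigmaCompact s) :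
    MeasurableSet s := by
  obtain ⟨K, hK, rfl⟩ := hs
  exact MeasurableSet.iUnion fun k => (hK k).measurableSet

/-- The optimal value of a parametric minimization problem with closed constraints and continuous
objective is a measurable function of the parameter. -/
theorem measurable_iInf_of_isClosed {X Y : Type*} [TopologicalSpace X] [SigmaCompactSpace X]
    [TopologicalSpace Y] [SigmaCompactSpace Y] [T2Space Y] [MeasurableSpace Y]
    [OpensMeasurableSpace Y] {T : Y → Set X} (hT : IsClosed {p : Y × X | p.2 ∈ T p.1})
    {g : Y → X → ℝ} (hg : Continuous fun p : Y × X => g p.1 p.2) :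
    Measurable fun y => ⨅ x ∈ T y, ((g y x : ℝ) : EReal) := by
  refine measurable_of_Iio fun a => ?_
  have : (fun y => ⨅ x ∈ T y, ((g y x : ℝ) : EReal)) ⁻¹' Set.Iio a
      = ⋃ q : {q : ℚ // ((q : ℝ) : EReal) < a},
        Prod.fst '' ({p : Y × X | p.2 ∈ T p.1} ∩ {p | g p.1 p.2 ≤ (q : ℝ)}) := by
    ext y
    simp only [Set.mem_preimage, Set.mem_Iio, iInf_lt_iff, Set.mem_iUnion, Set.mem_image,
      Set.mem_inter_iff, Set.mem_ofPred_eq]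
    constructor
    · rintro ⟨x, hx, hlt⟩
      obtain ⟨q, hq, hqa⟩ := EReal.lt_iff_exists_rat_btwn.mp hlt
      exact ⟨⟨q, hqa⟩, (y, x), ⟨hx, (EReal.coe_lt_coe_iff.mp hq).le⟩, rfl⟩
    · rintro ⟨⟨q, hqa⟩, ⟨y', x⟩, ⟨hx, hle⟩, rfl⟩
      exact ⟨x, hx, (EReal.coe_le_coe_iff.mpr hle).trans_lt hqa⟩
  rw [this]
  refine MeasurableSet.iUnion fun q => ?_
  have hcl := hT.inter (isClosed_le hg (continuous_const (y := ((q : ℚ) : ℝ))))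
  exact ((isSigmaCompact_univ.of_isClosed_subset hcl (Set.subset_univ _)).image
    continuous_fst).measurableSet

/-- **Lusin's theorem** for finite measures which are inner regular for compact sets. -/
theorem exists_isCompact_continuousOn {X Z : Type*} [TopologicalSpace X] [T2Space X]
    [MeasurableSpace X] [OpensMeasurableSpace X] (μ : Measure X) [IsFiniteMeasure μ]
    [μ.InnerRegularCompactLTTop] [TopologicalSpace Z] [SecondCountableTopology Z]
    [MeasurableSpace Z] [OpensMeasurableSpace Z] {f : X → Z} (hf : Measurable f) {S : Set X}
    (hS : MeasurableSet S) {ε : ENNReal} (hε : ε ≠ 0) :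
    ∃ K ⊆ S, IsCompact K ∧ ContinuousOn f K ∧ μ (S \ K) ≤ ε := by
  have hε2 : ε / 2 ≠ 0 := by simpa using hε
  have hε4 : ε / 2 / 2 ≠ 0 := by simpa using hε
  obtain ⟨η, hη, hηsum⟩ :=
    ENNReal.exists_pos_sum_of_countable' hε4 (TopologicalSpace.countableBasis Z)
  have hU : ∀ U : TopologicalSpace.countableBasis Z, MeasurableSet (f ⁻¹' (U : Set Z)) := fun U =>
    hf (TopologicalSpace.isOpen_of_mem_countableBasis U.2).measurableSet
  obtain ⟨K₀, hK₀S, hK₀, hμ₀⟩ := hS.exists_isCompact_sdiff_lt (measure_ne_top μ S) hε2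
  choose K₁ hK₁S hK₁ hμ₁ using fun U => (hS.inter (hU U)).exists_isCompact_sdiff_lt
    (measure_ne_top μ _) (hη U).ne'
  choose K₂ hK₂S hK₂ hμ₂ using fun U => (hS.diff (hU U)).exists_isCompact_sdiff_lt
    (measure_ne_top μ _) (hη U).ne'
  refine ⟨K₀ ∩ ⋂ U, (K₁ U ∪ K₂ U), fun x hx => hK₀S hx.1, ?_, ?_, ?_⟩
  · exact hK₀.inter_right (isClosed_iInter fun U => ((hK₁ U).union (hK₂ U)).isClosed)
  · rw [continuousOn_iff_continuous_domRestrict,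
      (TopologicalSpace.isBasis_countableBasis Z).continuous_iff]
    intro U hUb
    have : (Set.domRestrict (K₀ ∩ ⋂ U, (K₁ U ∪ K₂ U)) f) ⁻¹' U
        = Subtype.val ⁻¹' (K₂ ⟨U, hUb⟩)ᶜ := by
      ext ⟨x, hx⟩
      have h12 := Set.mem_iInter.mp hx.2 ⟨U, hUb⟩
      constructor
      · exact fun h h2 => (hK₂S ⟨U, hUb⟩ h2).2 h
      · exact fun h => (hK₁S ⟨U, hUb⟩ (h12.resolve_right h)).2
    rw [this]
    exact (hK₂ ⟨U, hUb⟩).isClosed.isOpen_compl.preimage continuous_subtype_val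
  · have hsub : S \ (K₀ ∩ ⋂ U, (K₁ U ∪ K₂ U)) ⊆ (S \ K₀) ∪
        ((⋃ U : TopologicalSpace.countableBasis Z, (S ∩ f ⁻¹' (U : Set Z)) \ K₁ U) ∪
          ⋃ U : TopologicalSpace.countableBasis Z, (S \ f ⁻¹' (U : Set Z)) \ K₂ U) := by
      rintro x ⟨hxS, hx⟩
      by_cases h0 : x ∈ K₀
      · right
        have : ∃ U, x ∉ K₁ U ∪ K₂ U := by
          by_contra! h
          exact hx ⟨h0, Set.mem_iInter.mpr h⟩
        obtain ⟨U, hxU⟩ := this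
        by_cases hfx : f x ∈ (U : Set Z)
        · exact Or.inl (Set.mem_iUnion.mpr ⟨U, ⟨hxS, hfx⟩, fun h => hxU (Or.inl h)⟩)
        · exact Or.inr (Set.mem_iUnion.mpr ⟨U, ⟨hxS, hfx⟩, fun h => hxU (Or.inr h)⟩)
      · exact Or.inl ⟨hxS, h0⟩
    calc μ (S \ (K₀ ∩ ⋂ U, (K₁ U ∪ K₂ U)))
        ≤ μ (S \ K₀) + (μ (⋃ U : TopologicalSpace.countableBasis Z, (S ∩ f ⁻¹' (U : Set Z)) \ K₁ U)
          + μ (⋃ U : TopologicalSpace.countableBasis Z, (S \ f ⁻¹' (U : Set Z)) \ K₂ U)) :=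
          (measure_mono hsub).trans ((measure_union_le _ _).trans
            (add_le_add le_rfl (measure_union_le _ _)))
      _ ≤ ε / 2 + (ε / 2 / 2 + ε / 2 / 2) := by
          refine add_le_add hμ₀.le (add_le_add ?_ ?_)
          · exact (measure_iUnion_le _).trans
              ((ENNReal.tsum_le_tsum fun U => (hμ₁ U).le).trans hηsum.le)
          · exact (measure_iUnion_le _).trans
              ((ENNReal.tsum_le_tsum fun U => (hμ₂ U).le).trans hηsum.le)
      _ = ε := by rw [ENNReal.add_halves, ENNReal.add_halves]

instance opensMeasurableSpace_sum {X Y : Type*} [TopologicalSpace X] [MeasurableSpace X]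
    [OpensMeasurableSpace X] [TopologicalSpace Y] [MeasurableSpace Y] [OpensMeasurableSpace Y] :
    OpensMeasurableSpace (X ⊕ Y) :=
  ⟨MeasurableSpace.generateFrom_le fun _ hs => measurableSet_sum_iff.mpr
    ⟨(hs.preimage continuous_inl).measurableSet, (hs.preimage continuous_inr).measurableSet⟩⟩

namespace MILP

variable {m n : ℕ}

set_option synthInstance.maxSize 4000 in
set_option synthInstance.maxHeartbeats 400000 in
instance opensMeasurableSpace : OpensMeasurableSpace (MILP m n) := inferInstance

set_option synthInstance.maxSize 4000 in
set_option synthInstance.maxHeartbeats 400000 in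
instance sigmaCompactSpace : SigmaCompactSpace (MILP m n) := inferInstance

theorem continuous_A : Continuous (A : MILP m n → Fin m → Fin n → ℝ) := by
  unfold A
  fun_prop

theorem continuous_b : Continuous (b : MILP m n → Fin m → ℝ) := by
  unfold b
  fun_prop

theorem continuous_c : Continuous (c : MILP m n → Fin n → ℝ) := by
  unfold c
  fun_prop

theorem continuous_sense : Continuous (sense : MILP m n → Fin m → Sense) := by
  unfold sense
  fun_prop

theorem continuous_lo : Continuous (lo : MILP m n → Fin n → ExtLo) := by
  unfold lo
  fun_prop

theorem continuous_hi : Continuous (hi : MILP m n → Fin n → ExtHi) := by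
  unfold hi
  fun_prop

theorem continuous_isInt : Continuous (isInt : MILP m n → Fin n → Bool) := by
  unfold isInt
  fun_prop

end MILP

attribute [fun_prop] MILP.continuous_A MILP.continuous_b MILP.continuous_c MILP.continuous_sense
  MILP.continuous_lo MILP.continuous_hi MILP.continuous_isInt

theorem isClosed_senseRel {X : Type*} [TopologicalSpace X] {s : X → Sense} {a b : X → ℝ}
    (hs : Continuous s) (ha : Continuous a) (hb : Continuous b) :
    IsClosed {x | senseRel (s x) (a x) (b x)} := by
  have h (t : Sense) : IsClosed (s ⁻¹' {t}) := isClosed_singleton.preimage hs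
  have : {x | senseRel (s x) (a x) (b x)}
      = (s ⁻¹' {0} ∩ {x | a x ≤ b x}) ∪ (s ⁻¹' {1} ∩ {x | a x = b x})
        ∪ (s ⁻¹' {2} ∩ {x | b x ≤ a x}) := by
    ext x
    simp only [Set.mem_ofPred_eq, Set.mem_inter_iff, Set.mem_union, Set.mem_preimage,
      Set.mem_singleton_iff, senseRel]
    generalize s x = t
    fin_cases t <;> simp
  rw [this]
  exact (((h 0).inter (isClosed_le ha hb)).union ((h 1).inter (isClosed_eq ha hb))).union
    ((h 2).inter (isClosed_le hb ha))

theorem isClosed_loSat {X : Type*} [TopologicalSpace X] {lo : X → ExtLo} {a : X → ℝ}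
    (hlo : Continuous lo) (ha : Continuous a) : IsClosed {x | loSat (lo x) (a x)} := by
  have h : Continuous (Sum.elim (fun t : ℝ => (t : EReal)) fun _ : Unit => ⊥) :=
    continuous_coe_real_ereal.sumElim continuous_const
  convert isClosed_le (h.comp hlo) (continuous_coe_real_ereal.comp ha) using 3 with x
  rcases hx : lo x with t | t <;> simp [loSat, hx]

theorem isClosed_hiSat {X : Type*} [TopologicalSpace X] {hi : X → ExtHi} {a : X → ℝ}
    (hhi : Continuous hi) (ha : Continuous a) : IsClosed {x | hiSat (hi x) (a x)} := by
  have h : Continuous (Sum.elim (fun t : ℝ => (t : EReal)) fun _ : Unit => ⊤) :=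
    continuous_coe_real_ereal.sumElim continuous_const
  convert isClosed_le (continuous_coe_real_ereal.comp ha) (h.comp hhi) using 3 with x
  rcases hx : hi x with t | t <;> simp [hiSat, hx]

theorem isClosed_mem_feasSetMod {X : Type*} [TopologicalSpace X] {m n : ℕ} {G : X → MILP m n}
    {j : Fin n} {lo : X → ExtLo} {hi : X → ExtHi} {a : X → Fin n → ℝ} (hG : Continuous G)
    (hlo : Continuous lo) (hhi : Continuous hi) (ha : Continuous a) :
    IsClosed {x | a x ∈ feasSetMod (G x) j (lo x) (hi x)} := by
  simp only [feasSetMod, consSat, Set.mem_ofPred_eq]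
  simp only [Set.ofPred_and, Set.ofPred_forall]
  refine (isClosed_iInter fun i => ?_).inter ((isClosed_iInter fun j' => isClosed_iInter fun _ =>
    IsClosed.inter ?_ ?_).inter (IsClosed.inter ?_ ?_))
  · exact isClosed_senseRel (by fun_prop) (by fun_prop) (by fun_prop)
  · exact isClosed_loSat (by fun_prop) (by fun_prop)
  · exact isClosed_hiSat (by fun_prop) (by fun_prop)
  · exact isClosed_loSat (by fun_prop) (by fun_prop)
  · exact isClosed_hiSat (by fun_prop) (by fun_prop)

theorem isClosed_mem_lpFeasSet {X : Type*} [TopologicalSpace X] {m n : ℕ} {G : X → MILP m n}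
    {a : X → Fin n → ℝ} (hG : Continuous G) (ha : Continuous a) :
    IsClosed {x | a x ∈ lpFeasSet (G x)} := by
  simp only [lpFeasSet, consSat, Set.mem_ofPred_eq]
  simp only [Set.ofPred_and, Set.ofPred_forall]
  refine (isClosed_iInter fun i => ?_).inter (isClosed_iInter fun j' => IsClosed.inter ?_ ?_)
  · exact isClosed_senseRel (by fun_prop) (by fun_prop) (by fun_prop)
  · exact isClosed_loSat (by fun_prop) (by fun_prop)
  · exact isClosed_hiSat (by fun_prop) (by fun_prop)

section Measurability

variable {m n : ℕ}

/-- The feasible points with objective value `v`. -/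
def levelSet (G : MILP m n) (v : ℝ) : Set (Fin n → ℝ) :=
  {x | x ∈ lpFeasSet G ∧ ∑ j, G.c j * x j = v}

/-- The feasible points with objective value `v` and squared norm `w`. -/
def normLevelSet (G : MILP m n) (v w : ℝ) : Set (Fin n → ℝ) :=
  {x | x ∈ levelSet G v ∧ ∑ j, x j ^ 2 = w}

theorem isClosed_mem_levelSet {X : Type*} [TopologicalSpace X] {G : X → MILP m n} {v : X → ℝ}
    {a : X → Fin n → ℝ} (hG : Continuous G) (hv : Continuous v) (ha : Continuous a) :
    IsClosed {x | a x ∈ levelSet (G x) (v x)} := by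
  simp only [levelSet, Set.ofPred_and]
  exact (isClosed_mem_lpFeasSet hG ha).inter (isClosed_eq (by fun_prop) hv)

theorem isClosed_mem_normLevelSet {X : Type*} [TopologicalSpace X] {G : X → MILP m n}
    {v w : X → ℝ} {a : X → Fin n → ℝ} (hG : Continuous G) (hv : Continuous v) (hw : Continuous w)
    (ha : Continuous a) : IsClosed {x | a x ∈ normLevelSet (G x) (v x) (w x)} := by
  simp only [normLevelSet, Set.ofPred_and]
  exact (isClosed_mem_levelSet hG hv ha).inter (isClosed_eq (by fun_prop) hw)

/-- The least squared norm of an optimal solution. -/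
def minNormSq (G : MILP m n) : EReal :=
  ⨅ x ∈ levelSet G (fstar G).toReal, ((∑ j, x j ^ 2 : ℝ) : EReal)

/-- The least `j`-th coordinate of an optimal solution of least norm. -/
def minNormCoord (G : MILP m n) (j : Fin n) : EReal :=
  ⨅ x ∈ normLevelSet G (fstar G).toReal (minNormSq G).toReal, ((x j : ℝ) : EReal)

/-- A variant of the strong branching score which is measurable on the whole space. -/
def measurableSB (G : MILP m n) (j : Fin n) : ℝ :=
  if G.isInt j then
    ((lpValMod G j (G.lo j) (Sum.inl (⌊(minNormCoord G j).toReal⌋ : ℝ))).toReal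
        - (fstar G).toReal)
      * ((lpValMod G j (Sum.inl (⌈(minNormCoord G j).toReal⌉ : ℝ)) (G.hi j)).toReal
        - (fstar G).toReal)
  else 0

theorem measurable_fstar : Measurable (fstar : MILP m n → EReal) :=
  measurable_iInf_of_isClosed (isClosed_mem_lpFeasSet continuous_fst continuous_snd)
    (g := fun G x => ∑ j, G.c j * x j) (by fun_prop)

theorem measurable_minNormSq : Measurable fun G : MILP m n => minNormSq G := by
  have h : Measurable fun p : MILP m n × ℝ =>
      ⨅ x ∈ levelSet p.1 p.2, ((∑ j, x j ^ 2 : ℝ) : EReal) :=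
    measurable_iInf_of_isClosed (Y := MILP m n × ℝ) (X := Fin n → ℝ)
      (T := fun p => levelSet p.1 p.2) (g := fun _ x => ∑ j, x j ^ 2)
      (isClosed_mem_levelSet (by fun_prop) (by fun_prop) (by fun_prop)) (by fun_prop)
  have h' : Measurable fun G : MILP m n => (G, (fstar G).toReal) :=
    measurable_id.prodMk measurable_fstar.ereal_toReal
  simpa only [Function.comp_def, minNormSq] using h.comp h'

theorem measurable_minNormCoord (j : Fin n) :
    Measurable fun G : MILP m n => minNormCoord G j := by
  have h : Measurable fun p : MILP m n × ℝ × ℝ =>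
      ⨅ x ∈ normLevelSet p.1 p.2.1 p.2.2, ((x j : ℝ) : EReal) :=
    measurable_iInf_of_isClosed (Y := MILP m n × ℝ × ℝ) (X := Fin n → ℝ)
      (T := fun p => normLevelSet p.1 p.2.1 p.2.2) (g := fun _ x => x j)
      (isClosed_mem_normLevelSet (by fun_prop) (by fun_prop) (by fun_prop) (by fun_prop))
      (by fun_prop)
  have h' : Measurable fun G : MILP m n => (G, (fstar G).toReal, (minNormSq G).toReal) :=
    measurable_id.prodMk
      (measurable_fstar.ereal_toReal.prodMk measurable_minNormSq.ereal_toReal)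
  simpa only [Function.comp_def, minNormCoord] using h.comp h'

theorem measurable_measurableSB : Measurable (measurableSB : MILP m n → Fin n → ℝ) := by
  refine measurable_pi_lambda _ fun j => ?_
  have hk := (measurable_minNormCoord (m := m) j).ereal_toReal
  have hdown : Measurable fun p : MILP m n × ℝ => lpValMod p.1 j (p.1.lo j) (Sum.inl p.2) :=
    measurable_iInf_of_isClosed (Y := MILP m n × ℝ) (X := Fin n → ℝ)
      (T := fun p => feasSetMod p.1 j (p.1.lo j) (Sum.inl p.2)) (g := fun p x => ∑ j, p.1.c j * x j)
      (isClosed_mem_feasSetMod (by fun_prop) (by fun_prop) (by fun_prop) (by fun_prop))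
      (by fun_prop)
  have hup : Measurable fun p : MILP m n × ℝ => lpValMod p.1 j (Sum.inl p.2) (p.1.hi j) :=
    measurable_iInf_of_isClosed (Y := MILP m n × ℝ) (X := Fin n → ℝ)
      (T := fun p => feasSetMod p.1 j (Sum.inl p.2) (p.1.hi j)) (g := fun p x => ∑ j, p.1.c j * x j)
      (isClosed_mem_feasSetMod (by fun_prop) (by fun_prop) (by fun_prop) (by fun_prop))
      (by fun_prop)
  have hbool : MeasurableSet {G : MILP m n | G.isInt j = true} :=
    ((isOpen_discrete {true}).preimage
      (show Continuous fun G : MILP m n => G.isInt j by fun_prop)).measurableSet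
  have cast : Measurable fun k : ℤ => (k : ℝ) := measurable_from_top
  have hfloor := hdown.comp (measurable_id.prodMk (cast.comp (Int.measurable_floor.comp hk)))
  have hceil := hup.comp (measurable_id.prodMk (cast.comp (Int.measurable_ceil.comp hk)))
  exact Measurable.ite hbool ((hfloor.ereal_toReal.sub measurable_fstar.ereal_toReal).mul
    (hceil.ereal_toReal.sub measurable_fstar.ereal_toReal)) measurable_const

theorem sum_sq_le_of_euclNorm_le {x y : Fin n → ℝ} (h : euclNorm x ≤ euclNorm y) :
    ∑ j, x j ^ 2 ≤ ∑ j, y j ^ 2 :=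
  (Real.sqrt_le_sqrt_iff (by positivity)).mp h

theorem isOptSol_iff {G : MILP m n} (ht : fstar G ≠ ⊤) (hb : fstar G ≠ ⊥) {x : Fin n → ℝ} :
    IsOptSol G x ↔ x ∈ levelSet G (fstar G).toReal := by
  refine and_congr_right fun _ => ?_
  rw [← EReal.coe_eq_coe_iff, EReal.coe_toReal ht hb]

theorem minNormSq_eq {G : MILP m n} (ht : fstar G ≠ ⊤) (hb : fstar G ≠ ⊥) {x : Fin n → ℝ}
    (hx : IsMinNormOpt G x) : minNormSq G = ((∑ j, x j ^ 2 : ℝ) : EReal) := by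
  refine le_antisymm (iInf₂_le x ((isOptSol_iff ht hb).mp hx.1)) (le_iInf₂ fun y hy => ?_)
  exact EReal.coe_le_coe_iff.mpr
    (sum_sq_le_of_euclNorm_le (hx.2 y ((isOptSol_iff ht hb).mpr hy)))

theorem minNormCoord_eq {G : MILP m n} (ht : fstar G ≠ ⊤) (hb : fstar G ≠ ⊥) {x : Fin n → ℝ}
    (hx : IsMinNormOpt G x) (j : Fin n) : minNormCoord G j = (x j : EReal) := by
  have hsq := minNormSq_eq ht hb hx
  have hopt := (isOptSol_iff ht hb).mp hx.1
  refine le_antisymm (iInf₂_le x ⟨hopt, by rw [hsq, EReal.toReal_coe]⟩)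
    (le_iInf₂ fun y hy => ?_)
  have hy2 : ∑ j, y j ^ 2 = ∑ j, x j ^ 2 := by rw [hy.2, hsq, EReal.toReal_coe]
  have hyx : euclNorm y = euclNorm x := by rw [euclNorm, euclNorm, hy2]
  have hymin : IsMinNormOpt G y :=
    ⟨(isOptSol_iff ht hb).mpr hy.1, fun z hz => hyx.trans_le (hx.2 z hz)⟩
  rw [hx.eq hymin]

theorem exists_isMinNormOpt {G : MILP m n} (ht : fstar G ≠ ⊤) (hb : fstar G ≠ ⊥) {j : Fin n}
    (hj : minNormCoord G j ≠ ⊤) : ∃ x, IsMinNormOpt G x := by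
  obtain ⟨x, hx, hxn⟩ : ∃ x, x ∈ normLevelSet G (fstar G).toReal (minNormSq G).toReal := by
    by_contra! h
    exact hj (iInf₂_eq_top.mpr fun x hx => absurd hx (by simp [h]))
  refine ⟨x, (isOptSol_iff ht hb).mpr hx, fun y hy => Real.sqrt_le_sqrt ?_⟩
  rw [hxn]
  have hle : minNormSq G ≤ ((∑ j, y j ^ 2 : ℝ) : EReal) :=
    iInf₂_le y ((isOptSol_iff ht hb).mp hy)
  have h0 : 0 ≤ minNormSq G := le_iInf₂ fun z _ => by
    exact_mod_cast Finset.sum_nonneg fun j _ => sq_nonneg (z j)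
  simpa using EReal.toReal_le_toReal hle (EReal.bot_lt_zero.trans_le h0).ne' (EReal.coe_ne_top _)

theorem measurableSB_eq {G : MILP m n} (ht : fstar G ≠ ⊤) (hb : fstar G ≠ ⊥)
    (h : ∃ x, IsMinNormOpt G x) : measurableSB G = SB G := by
  funext j
  rw [measurableSB, SB, branchDown, branchUp, minNormCoord_eq ht hb (isMinNormOpt_xstar h),
    EReal.toReal_coe]

/-- The instances whose relaxation has a finite value and an optimal solution of least norm. -/
def solvableSet (m n : ℕ) : Set (MILP m n) :=
  {G | fstar G ≠ ⊤ ∧ fstar G ≠ ⊥ ∧ ∀ j, minNormCoord G j ≠ ⊤}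

theorem measurableSet_solvableSet : MeasurableSet (solvableSet m n) := by
  refine ((measurableSet_singleton ⊤).compl.preimage measurable_fstar).inter
    (((measurableSet_singleton ⊥).compl.preimage measurable_fstar).inter ?_)
  refine MeasurableSet.congr (MeasurableSet.iInter fun j =>
    (measurableSet_singleton ⊤).compl.preimage (measurable_minNormCoord j)) ?_
  ext G
  exact Set.mem_iInter

theorem SBRealValued.mem_solvableSet {G : MILP m n} (h : SBRealValued G) : G ∈ solvableSet m n := by
  obtain ⟨⟨x, hx⟩, ht, hb, -⟩ := h
  exact ⟨ht, hb, fun j => by rw [minNormCoord_eq ht hb hx]; exact EReal.coe_ne_top _⟩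

end Measurability

/-- A continuous function on a compact space which factors through a continuous map `Ψ` to a normal
Hausdorff space factors through `Ψ` via a continuous function. -/
theorem exists_continuous_comp_eq {X E : Type*} [TopologicalSpace X] [CompactSpace X]
    [TopologicalSpace E] [T2Space E] [NormalSpace E] {Ψ : X → E} (hΨ : Continuous Ψ) {φ : X → ℝ}
    (hφ : Continuous φ) (h : ∀ x y, Ψ x = Ψ y → φ x = φ y) :
    ∃ r : E → ℝ, Continuous r ∧ ∀ x, r (Ψ x) = φ x := by
  have hq : Topology.IsQuotientMap (Set.rangeFactorization Ψ) :=
    (hΨ.rangeFactorization.isClosedMap).isQuotientMap hΨ.rangeFactorization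
      Set.rangeFactorization_surjective
  let f : C(X, Set.range Ψ) := ⟨Set.rangeFactorization Ψ, hΨ.rangeFactorization⟩
  have hf : Topology.IsQuotientMap f := hq
  obtain ⟨r, hr⟩ := ContinuousMap.exists_restrict_eq (isCompact_range hΨ).isClosed
    (hf.lift ⟨φ, hφ⟩ fun x y hxy => h x y (congrArg Subtype.val hxy))
  refine ⟨r, r.continuous, fun x => ?_⟩
  have h1 := DFunLike.congr_fun hr (f x)
  have h2 := DFunLike.congr_fun
    (hf.lift_comp ⟨φ, hφ⟩ fun x y hxy => h x y (congrArg Subtype.val hxy)) x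
  exact h1.trans h2

namespace FGNN2

variable {m n : ℕ}

theorem continuous_st (N : FGNN2 m n) (l : ℕ) :
    (∀ i j, Continuous fun G => (st N G l).1 i j) ∧
      ∀ j₁ j₂, Continuous fun G => (st N G l).2 j₁ j₂ := by
  induction l with
  | zero =>
    refine ⟨fun i j => N.p0_cont.comp ?_, fun j₁ j₂ => N.q0_cont.comp ?_⟩ <;> fun_prop
  | succ l ih =>
    obtain ⟨hs, ht⟩ := ih
    refine ⟨fun i j => (N.p_cont l).comp ((hs i j).prodMk
        (continuous_finsetSum _ fun j₁ _ => (N.f_cont l).comp ((ht j₁ j).prodMk (hs i j₁)))),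
      fun j₁ j₂ => (N.q_cont l).comp ((ht j₁ j₂).prodMk
        (continuous_finsetSum _ fun i _ => (N.g_cont l).comp ((hs i j₂).prodMk (hs i j₁))))⟩

/-- Replace the output function of a 2-FGNN. -/
def withOutput (N : FGNN2 m n) (r : (Fin (N.d N.L) → ℝ) × (Fin (N.d N.L) → ℝ) → ℝ)
    (hr : Continuous r) : FGNN2 m n :=
  { N with r := r, r_cont := hr }

theorem st_withOutput (N : FGNN2 m n) (r) (hr : Continuous r) (G : MILP m n) (l : ℕ) :
    st (N.withOutput r hr) G l = st N G l := by
  induction l with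
  | zero => rfl
  | succ l ih =>
    simp only [st, ih]
    rfl

theorem eval_withOutput (N : FGNN2 m n) (r) (hr : Continuous r) (G : MILP m n) (j : Fin n) :
    eval (N.withOutput r hr) G j = r (∑ i, (st N G N.L).1 i j, ∑ j₁, (st N G N.L).2 j₁ j) := by
  simp only [eval, st_withOutput]
  rfl

/-- On a compact set of instances having least norm solutions, on which the strong branching score
is continuous, some 2-FGNN computes the score exactly. -/
theorem exists_eval_eq_SB (hm : 1 ≤ m) (hn : 1 ≤ n) {K : Set (MILP m n)} (hK : IsCompact K)
    (hSB : ContinuousOn SB K) (hopt : ∀ G ∈ K, ∃ x, IsMinNormOpt G x) :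
    ∃ F : FGNN2 m n, ∀ G ∈ K, eval F G = SB G := by
  have : Nonempty (Fin m) := ⟨⟨0, hm⟩⟩
  have : Nonempty (Fin n) := ⟨⟨0, hn⟩⟩
  obtain ⟨N, hL, hN⟩ := exists_isSeparating m n hm hn (Fintype.card (ColorPairs m n))
  have : CompactSpace K := isCompact_iff_compactSpace.mp hK
  obtain ⟨hs, ht⟩ := continuous_st N N.L
  let Ψ (p : Fin n × K) := (∑ i, (st N (p.2 : MILP m n) N.L).1 i p.1,
    ∑ j₁, (st N (p.2 : MILP m n) N.L).2 j₁ p.1)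
  have hΨ : Continuous Ψ := continuous_prod_of_discrete_left.mpr fun j =>
    (continuous_finsetSum _ fun i _ => (hs i j).comp continuous_subtype_val).prodMk
      (continuous_finsetSum _ fun i _ => (ht i j).comp continuous_subtype_val)
  have hφ : Continuous fun p : Fin n × K => SB (p.2 : MILP m n) p.1 :=
    continuous_prod_of_discrete_left.mpr fun j => (continuous_apply j).comp hSB.domRestrict
  obtain ⟨r, hr, hreq⟩ := exists_continuous_comp_eq hΨ hφ fun ⟨j, G, hG⟩ ⟨j', G', hG'⟩ h => by
    obtain ⟨h1, h2⟩ := Prod.mk.inj h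
    obtain ⟨l, he⟩ := hN.exists_equitable hL.ge h1 h2
    exact he.SB_eq (hopt G hG) (hopt G' hG')
  refine ⟨N.withOutput r hr, fun G hG => funext fun j => ?_⟩
  rw [eval_withOutput]
  exact hreq (j, ⟨G, hG⟩)

end FGNN2

/-- For any Borel regular probability distribution over MILP instances
supported on instances with real-valued SB scores, 2-FGNNs can approximate the strong
branching scores to arbitrary accuracy with arbitrarily high probability. -/
theorem fgnn2_universally_approximates_SB
    (m n : ℕ) (hm : 1 ≤ m) (hn : 1 ≤ n)
    (μ : Measure (MILP m n)) (hprob : IsProbabilityMeasure μ) (hreg : μ.Regular)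
    (hSB : μ {G | SBRealValued G} = 1)
    (ε δ : ℝ) (hε : 0 < ε) (hδ : 0 < δ) :
    ∃ F : FGNN2 m n,
      1 - ENNReal.ofReal ε ≤ μ {G | euclDist (FGNN2.eval F G) (SB G) ≤ δ} := by
  obtain ⟨K, hKS, hK, hcont, hμK⟩ := exists_isCompact_continuousOn μ
    (measurable_measurableSB (m := m) (n := n)) measurableSet_solvableSet
    (ENNReal.ofReal_pos.mpr hε).ne'
  have hopt : ∀ G ∈ K, ∃ x, IsMinNormOpt G x := fun G hG =>
    exists_isMinNormOpt (hKS hG).1 (hKS hG).2.1 ((hKS hG).2.2 ⟨0, hn⟩)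
  obtain ⟨F, hF⟩ := FGNN2.exists_eval_eq_SB hm hn hK
    (hcont.congr fun G hG => (measurableSB_eq (hKS hG).1 (hKS hG).2.1 (hopt G hG)).symm) hopt
  refine ⟨F, ?_⟩
  have hone : 1 ≤ μ (solvableSet m n) :=
    hSB.ge.trans (measure_mono fun G hG => SBRealValued.mem_solvableSet hG)
  calc 1 - ENNReal.ofReal ε ≤ μ (solvableSet m n) - μ (solvableSet m n \ K) :=
        tsub_le_tsub hone hμK
    _ ≤ μ K := by
        rw [tsub_le_iff_left]
        exact (measure_mono fun G hG => (em (G ∈ K)).elim Or.inr fun h => Or.inl ⟨hG, h⟩).trans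
          (measure_union_le _ _)
    _ ≤ μ {G | euclDist (FGNN2.eval F G) (SB G) ≤ δ} := by
        refine measure_mono fun G hG => ?_
        simp [hF G hG, euclDist, euclNorm, hδ.le]
end
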